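/- Let 𝒳, 𝒴, 𝓑 be finite sets and π_{XY} a distribution on 𝒳×𝒴. Consider sequential codes with restricted encoders and decoders: at epoch k the encoder uses a conditional distribution P_{B_k|X^k} and the decoder uses a conditional distribution P_{Y_k|B^k Y^{k-1}} (no common randomness and no dependence of the encoder on past communication bits). Let Γ̃₀(π_{XY}) := lim_{n→∞} (1/n) times the infimum over such codes of blocklength n of D(P_{Y^n|X^n} ‖ π_{Y|X}^n | π_X^n). Then Γ̃₀(π_{XY}) = Δ̃(π_{XY}) := inf over conditional distributions P_{B|X} (B ∈ 𝓑) and P_{Y|B} of D(P_{Y|X} ‖ π_{Y|X} | π_X), where P_{Y|X} is induced by the joint distribution π_X P_{B|X} P_{Y|B}. -/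

import Mathlib

open scoped BigOperators ENNReal
open Classical

noncomputable section

/-- `p` is a probability mass function on the finite type `α`. -/
def IsDist {α : Type} [Fintype α] (p : α → ℝ) : Prop :=
  (∀ a, 0 ≤ p a) ∧ (∑ a, p a) = 1

/-- `k` is a conditional probability kernel. -/
def IsKernel {α β : Type} [Fintype β] (k : α → β → ℝ) : Prop :=
  ∀ a, (∀ b, 0 ≤ k a b) ∧ (∑ b, k a b) = 1

/-- Marginal (pushforward) of `p` along the map `f`. -/
def marg {α β : Type} [Fintype α] (f : α → β) (p : α → ℝ) : β → ℝ :=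
  fun b => ∑ a, if f a = b then p a else 0

/-- Shannon entropy (natural log). -/
def ent {α : Type} [Fintype α] (p : α → ℝ) : ℝ :=
  ∑ a, Real.negMulLog (p a)

/-- Conditional entropy `H(f(A) | g(A))` for `A ∼ p`. -/
def condEnt {α β γ : Type} [Fintype α] [Fintype β] [Fintype γ]
    (f : α → β) (g : α → γ) (p : α → ℝ) : ℝ :=
  ent (marg (fun a => (f a, g a)) p) - ent (marg g p)

/-- Kullback–Leibler divergence `D(p‖q)` with value `⊤` if `p` is not absolutely
continuous with respect to `q`. -/
def KL {α : Type} [Fintype α] (p q : α → ℝ) : ℝ≥0∞ :=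
  if ∀ a, q a = 0 → p a = 0 then ENNReal.ofReal (∑ a, p a * Real.log (p a / q a)) else ⊤


/-- A restricted sequential code of blocklength `n`: at epoch `k` the encoder
generates `B_k` from `X^k` only, and the decoder generates `Y_k` from
`(B^k, Y^{k-1})`; there is no common randomness. -/
structure RSeqCode (X Y B : Type) [Fintype X] [Fintype Y] [Fintype B] (n : ℕ) where
  enc : Fin n → (Fin n → X) → B → ℝ
  dec : Fin n → (Fin n → B) → (Fin n → Y) → Y → ℝ
  enc_dist : ∀ k x, IsDist (enc k x)
  dec_dist : ∀ k b y, IsDist (dec k b y)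
  enc_causal : ∀ k x x', (∀ i, i ≤ k → x i = x' i) → enc k x = enc k x'
  dec_causal : ∀ k b b' y y',
    (∀ i, i ≤ k → b i = b' i) → (∀ i, i < k → y i = y' i) → dec k b y = dec k b' y'

/-- The channel `P_{Y^n|X^n}` synthesized by a restricted sequential code. -/
def RSeqCode.channel {X Y B : Type} [Fintype X] [Fintype Y] [Fintype B] {n : ℕ}
    (C : RSeqCode X Y B n) (x : Fin n → X) (y : Fin n → Y) : ℝ :=
  ∑ b : Fin n → B, (∏ k, C.enc k x (b k)) * (∏ k, C.dec k b y (y k))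

/-- `Γ̃₀^{(n)}`: least divergence over restricted sequential codes of blocklength `n`. -/
def RGammaN (X Y B : Type) [Fintype X] [Fintype Y] [Fintype B]
    (π : X × Y → ℝ) (n : ℕ) : ℝ≥0∞ :=
  sInf { d | ∃ C : RSeqCode X Y B n,
    d = KL
      (fun p : (Fin n → X) × (Fin n → Y) =>
        (∏ i, marg Prod.fst π (p.1 i)) * C.channel p.1 p.2)
      (fun p : (Fin n → X) × (Fin n → Y) => ∏ i, π (p.1 i, p.2 i)) }

/-- `Δ̃(π_{XY})`: the least value of `D(P_{Y|X}‖π_{Y|X}|π_X)` over symbol-by-symbol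
schemes `P_{B|X}, P_{Y|B}`, with `P_{Y|X}` induced by `π_X P_{B|X} P_{Y|B}`. -/
def DeltaTilde (X Y B : Type) [Fintype X] [Fintype Y] [Fintype B]
    (π : X × Y → ℝ) : ℝ≥0∞ :=
  sInf { d | ∃ (PB : X → B → ℝ) (PYB : B → Y → ℝ), IsKernel PB ∧ IsKernel PYB ∧
    d = KL
      (fun p : X × Y => marg Prod.fst π p.1 * ∑ b, PB p.1 b * PYB b p.2) π }

theorem IsDist.sum_mul_log_div_nonneg {α : Type} [Fintype α] {p q : α → ℝ}
    (hp : IsDist p) (hq : IsDist q) (hpq : ∀ a, q a = 0 → p a = 0) :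
    0 ≤ ∑ a, p a * Real.log (p a / q a) := by
  have key : ∀ a, p a - q a ≤ p a * Real.log (p a / q a) := by
    intro a
    rcases (hp.1 a).eq_or_lt with h | h
    · simp [← h, hq.1 a]
    · have hqa : 0 < q a :=
        lt_of_le_of_ne (hq.1 a) fun h0 => h.ne' (hpq a h0.symm)
      have h1 := Real.one_sub_inv_le_log_of_pos (div_pos h hqa)
      have h2 := mul_le_mul_of_nonneg_left h1 h.le
      have h3 : p a * (1 - (p a / q a)⁻¹) = p a - q a := by field_simp
      linarith
  calc (0 : ℝ) = ∑ a, (p a - q a) := by simp [Finset.sum_sub_distrib, hp.2, hq.2]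
    _ ≤ _ := Finset.sum_le_sum fun a _ => key a

theorem sum_mul_log_div_chain {α β : Type} [Fintype α] [Fintype β] {p q : α → ℝ}
    {R : α → β → ℝ} {r : β → ℝ} (hR : ∀ a, IsDist (R a))
    (hpq : ∀ a, q a = 0 → p a = 0) (hRr : ∀ a, p a ≠ 0 → ∀ b, r b = 0 → R a b = 0) :
    ∑ z : α × β, p z.1 * R z.1 z.2 * Real.log (p z.1 * R z.1 z.2 / (q z.1 * r z.2)) =
      (∑ a, p a * Real.log (p a / q a)) +
        ∑ a, p a * ∑ b, R a b * Real.log (R a b / r b) := by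
  rw [Fintype.sum_prod_type, ← Finset.sum_add_distrib]
  refine Finset.sum_congr rfl fun a _ => ?_
  have h : ∀ b, p a * R a b * Real.log (p a * R a b / (q a * r b)) =
      p a * Real.log (p a / q a) * R a b + p a * (R a b * Real.log (R a b / r b)) := by
    intro b
    by_cases hpa : p a = 0
    · simp [hpa]
    by_cases hRa : R a b = 0
    · simp [hRa]
    have hqa : q a ≠ 0 := fun h0 => hpa (hpq a h0)
    have hrb : r b ≠ 0 := fun h0 => hRa (hRr a hpa b h0)
    rw [mul_div_mul_comm, Real.log_mul (div_ne_zero hpa hqa) (div_ne_zero hRa hrb)]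
    ring
  simp_rw [h, Finset.sum_add_distrib, ← Finset.mul_sum, (hR a).2, mul_one]

theorem KL_add_le_KL_chain {α β : Type} [Fintype α] [Fintype β] {p q : α → ℝ}
    {R : α → β → ℝ} {r : β → ℝ} {δ : ℝ≥0∞} (hp : IsDist p) (hq : IsDist q)
    (hR : ∀ a, IsDist (R a)) (hr : IsDist r) (hδ : ∀ a, δ ≤ KL (R a) r) :
    KL p q + δ ≤ KL (fun z : α × β => p z.1 * R z.1 z.2) (fun z => q z.1 * r z.2) := by
  by_cases hac : ∀ z : α × β, q z.1 * r z.2 = 0 → p z.1 * R z.1 z.2 = 0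
  swap
  · exact le_top.trans_eq (if_neg hac).symm
  have hpq : ∀ a, q a = 0 → p a = 0 := by
    intro a ha
    have h : ∑ b, p a * R a b = 0 :=
      Finset.sum_eq_zero fun b _ => hac (a, b) (by simp [ha])
    rwa [← Finset.mul_sum, (hR a).2, mul_one] at h
  have hRr : ∀ a, p a ≠ 0 → ∀ b, r b = 0 → R a b = 0 := fun a ha b hb =>
    (mul_eq_zero.1 (hac (a, b) (by simp [hb]))).resolve_left ha
  have hKL : ∀ a, p a ≠ 0 →
      δ ≤ ENNReal.ofReal (∑ b, R a b * Real.log (R a b / r b)) := by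
    intro a ha
    have := hδ a
    rwa [KL, if_pos (hRr a ha)] at this
  obtain ⟨a₀, ha₀⟩ : ∃ a, p a ≠ 0 := by
    by_contra! h
    simpa [h] using hp.2
  have hδ_top : δ ≠ ⊤ := ne_top_of_le_ne_top ENNReal.ofReal_ne_top (hKL a₀ ha₀)
  have hge : δ.toReal ≤ ∑ a, p a * ∑ b, R a b * Real.log (R a b / r b) := by
    calc δ.toReal = ∑ a, p a * δ.toReal := by rw [← Finset.sum_mul, hp.2, one_mul]
      _ ≤ _ := Finset.sum_le_sum fun a _ => by
        by_cases ha : p a = 0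
        · simp [ha]
        · refine mul_le_mul_of_nonneg_left ?_ (hp.1 a)
          exact ENNReal.toReal_le_of_le_ofReal
            ((hR a).sum_mul_log_div_nonneg hr (hRr a ha)) (hKL a ha)
  rw [KL, KL, if_pos hpq, if_pos hac, sum_mul_log_div_chain hR hpq hRr,
    ← ENNReal.ofReal_toReal hδ_top,
    ← ENNReal.ofReal_add (hp.sum_mul_log_div_nonneg hq hpq) ENNReal.toReal_nonneg]
  exact ENNReal.ofReal_le_ofReal (by gcongr)

theorem KL_prod_le {α β : Type} [Fintype α] [Fintype β] {p q : α → ℝ} {R r : β → ℝ}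
    (hp : IsDist p) (hR : IsDist R) :
    KL (fun z : α × β => p z.1 * R z.2) (fun z => q z.1 * r z.2) ≤ KL p q + KL R r := by
  by_cases hpq : ∀ a, q a = 0 → p a = 0
  swap
  · simp [KL, if_neg hpq]
  by_cases hRr : ∀ b, r b = 0 → R b = 0
  swap
  · simp [KL, if_neg hRr]
  have hac : ∀ z : α × β, q z.1 * r z.2 = 0 → p z.1 * R z.2 = 0 := fun z hz => by
    rcases mul_eq_zero.1 hz with h | h
    · simp [hpq _ h]
    · simp [hRr _ h]
  have hchain := sum_mul_log_div_chain (R := fun _ : α => R) (r := r)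
    (fun _ => hR) hpq (fun _ _ => hRr)
  rw [← Finset.sum_mul, hp.2, one_mul] at hchain
  rw [KL, KL, KL, if_pos hpq, if_pos hRr, if_pos hac, hchain]
  exact ENNReal.ofReal_add_le

theorem KL_comp_equiv {α β : Type} [Fintype α] [Fintype β] (e : α ≃ β) (p q : β → ℝ) :
    KL (fun a => p (e a)) (fun a => q (e a)) = KL p q := by
  have h1 : (∀ a, q (e a) = 0 → p (e a) = 0) ↔ ∀ b, q b = 0 → p b = 0 :=
    e.forall_congr_left.trans (by simp)
  simp only [KL, h1, e.sum_comp (fun b => p b * Real.log (p b / q b))]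

theorem IsDist.of_comp_equiv {α β : Type} [Fintype α] [Fintype β] (e : α ≃ β) {p : β → ℝ}
    (h : IsDist fun a => p (e a)) : IsDist p :=
  ⟨fun b => by simpa using h.1 (e.symm b), by rw [← e.sum_comp]; exact h.2⟩

theorem IsDist.chain {α β : Type} [Fintype α] [Fintype β] {p : α → ℝ} {R : α → β → ℝ}
    (hp : IsDist p) (hR : ∀ a, IsDist (R a)) :
    IsDist (fun z : α × β => p z.1 * R z.1 z.2) :=
  ⟨fun z => mul_nonneg (hp.1 _) ((hR _).1 _), by
    simp_rw [Fintype.sum_prod_type, ← Finset.mul_sum, (hR _).2, mul_one, hp.2]⟩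

/-- Appending one letter to each of a pair of words. -/
def snocPairEquiv (X Y : Type) (n : ℕ) :
    ((Fin n → X) × (Fin n → Y)) × (X × Y) ≃ (Fin (n + 1) → X) × (Fin (n + 1) → Y) where
  toFun q := (Fin.snoc (α := fun _ => X) q.1.1 q.2.1, Fin.snoc (α := fun _ => Y) q.1.2 q.2.2)
  invFun p := ((fun i => p.1 i.castSucc, fun i => p.2 i.castSucc),
    (p.1 (Fin.last n), p.2 (Fin.last n)))
  left_inv q := by simp
  right_inv p := by
    refine Prod.ext ?_ ?_
    · exact Fin.snoc_init_self p.1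
    · exact Fin.snoc_init_self p.2

theorem prod_snocPairEquiv {X Y : Type} {n : ℕ} (f : X × Y → ℝ)
    (z : ((Fin n → X) × (Fin n → Y)) × (X × Y)) :
    ∏ i, f ((snocPairEquiv X Y n z).1 i, (snocPairEquiv X Y n z).2 i) =
      (∏ i, f (z.1.1 i, z.1.2 i)) * f z.2 := by
  simp [snocPairEquiv, Fin.prod_univ_castSucc]

theorem IsDist.pi_pair {X Y : Type} [Fintype X] [Fintype Y] {f : X × Y → ℝ} (hf : IsDist f)
    (n : ℕ) : IsDist (fun p : (Fin n → X) × (Fin n → Y) => ∏ i, f (p.1 i, p.2 i)) := by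
  induction n with
  | zero => exact ⟨fun _ => by simp, by simp⟩
  | succ n ih =>
    refine IsDist.of_comp_equiv (snocPairEquiv X Y n) ?_
    simp only [prod_snocPairEquiv]
    exact ih.chain fun _ => hf

theorem KL_pi_pair_le {X Y : Type} [Fintype X] [Fintype Y] {f : X × Y → ℝ} (hf : IsDist f)
    (g : X × Y → ℝ) (n : ℕ) :
    KL (fun p : (Fin n → X) × (Fin n → Y) => ∏ i, f (p.1 i, p.2 i))
      (fun p => ∏ i, g (p.1 i, p.2 i)) ≤ n * KL f g := by
  induction n with
  | zero => simp [KL]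
  | succ n ih =>
    rw [← KL_comp_equiv (snocPairEquiv X Y n)]
    simp only [prod_snocPairEquiv]
    refine (KL_prod_le (q := fun p : (Fin n → X) × (Fin n → Y) => ∏ i, g (p.1 i, p.2 i))
      (r := g) (hf.pi_pair n) hf).trans ?_
    rw [Nat.cast_succ, add_mul, one_mul]
    gcongr

theorem IsDist.marg_fst {X Y : Type} [Fintype X] [Fintype Y] {π : X × Y → ℝ} (hπ : IsDist π) :
    IsDist (marg Prod.fst π) := by
  refine ⟨fun x => Finset.sum_nonneg fun a _ => ?_, ?_⟩
  · split_ifs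
    exacts [hπ.1 a, le_rfl]
  · simp only [marg]
    rw [Finset.sum_comm]
    simpa using hπ.2

theorem IsDist.marg_mul_kernel {X Y B : Type} [Fintype X] [Fintype Y] [Fintype B]
    {π : X × Y → ℝ} (hπ : IsDist π) {PB : X → B → ℝ} {PYB : B → Y → ℝ}
    (hPB : IsKernel PB) (hPYB : IsKernel PYB) :
    IsDist (fun p : X × Y => marg Prod.fst π p.1 * ∑ b, PB p.1 b * PYB b p.2) := by
  refine hπ.marg_fst.chain fun x => ⟨fun y => Finset.sum_nonneg fun b _ =>
    mul_nonneg ((hPB x).1 b) ((hPYB b).1 y), ?_⟩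
  rw [Finset.sum_comm]
  simp_rw [← Finset.mul_sum, (hPYB _).2, mul_one, (hPB x).2]

/-- The memoryless code that uses the same encoder and decoder at every epoch. -/
def RSeqCode.memoryless {X Y B : Type} [Fintype X] [Fintype Y] [Fintype B]
    {PB : X → B → ℝ} {PYB : B → Y → ℝ} (hPB : IsKernel PB) (hPYB : IsKernel PYB) (n : ℕ) :
    RSeqCode X Y B n where
  enc k x := PB (x k)
  dec k b _ := PYB (b k)
  enc_dist k x := hPB (x k)
  dec_dist k b _ := hPYB (b k)
  enc_causal k x x' h := by rw [h k le_rfl]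
  dec_causal k b b' _ _ h _ := by rw [h k le_rfl]

theorem RSeqCode.memoryless_channel {X Y B : Type} [Fintype X] [Fintype Y] [Fintype B]
    {PB : X → B → ℝ} {PYB : B → Y → ℝ} (hPB : IsKernel PB) (hPYB : IsKernel PYB) (n : ℕ)
    (x : Fin n → X) (y : Fin n → Y) :
    (RSeqCode.memoryless hPB hPYB n).channel x y = ∏ i, ∑ b, PB (x i) b * PYB b (y i) := by
  simp only [RSeqCode.channel, RSeqCode.memoryless, ← Finset.prod_mul_distrib]
  exact (Fintype.prod_sum fun i b => PB (x i) b * PYB b (y i)).symm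

theorem RGammaN_le {X Y B : Type} [Fintype X] [Fintype Y] [Fintype B]
    {π : X × Y → ℝ} (hπ : IsDist π) {PB : X → B → ℝ} {PYB : B → Y → ℝ}
    (hPB : IsKernel PB) (hPYB : IsKernel PYB) (n : ℕ) :
    RGammaN X Y B π n ≤
      n * KL (fun p : X × Y => marg Prod.fst π p.1 * ∑ b, PB p.1 b * PYB b p.2) π := by
  refine le_trans (b := KL _ _) (sInf_le ⟨RSeqCode.memoryless hPB hPYB n, rfl⟩) ?_
  simp only [RSeqCode.memoryless_channel, ← Finset.prod_mul_distrib]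
  exact KL_pi_pair_le (hπ.marg_mul_kernel hPB hPYB) π n

/-- The code formed by all but the last epoch; the values past the end are irrelevant by
causality. -/
def RSeqCode.init {X Y B : Type} [Fintype X] [Fintype Y] [Fintype B] {n : ℕ}
    (C : RSeqCode X Y B (n + 1)) (x₀ : X) (b₀ : B) (y₀ : Y) : RSeqCode X Y B n where
  enc k x := C.enc k.castSucc (Fin.snoc (α := fun _ => X) x x₀)
  dec k b y := C.dec k.castSucc (Fin.snoc (α := fun _ => B) b b₀)
    (Fin.snoc (α := fun _ => Y) y y₀)
  enc_dist _ _ := C.enc_dist _ _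
  dec_dist _ _ _ := C.dec_dist _ _ _
  enc_causal k x x' h := C.enc_causal _ _ _ fun i hi => by
    induction i using Fin.lastCases with
    | last => simp
    | cast j => simpa using h j (by simpa using hi)
  dec_causal k b b' y y' hb hy := by
    refine C.dec_causal _ _ _ _ _ (fun i hi => ?_) (fun i hi => ?_)
    · induction i using Fin.lastCases with
      | last => simp
      | cast j => simpa using hb j (by simpa using hi)
    · induction i using Fin.lastCases with
      | last => simp
      | cast j => simpa using hy j (by simpa using hi)

theorem RSeqCode.channel_snoc {X Y B : Type} [Fintype X] [Fintype Y] [Fintype B] {n : ℕ}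
    (C : RSeqCode X Y B (n + 1)) (x₀ : X) (b₀ : B) (y₀ : Y)
    (x : Fin n → X) (a : X) (y : Fin n → Y) (c : Y) :
    C.channel (Fin.snoc (α := fun _ => X) x a) (Fin.snoc (α := fun _ => Y) y c) =
      ∑ b : Fin n → B, ∑ b' : B,
        ((∏ k, (C.init x₀ b₀ y₀).enc k x (b k)) * ∏ k, (C.init x₀ b₀ y₀).dec k b y (y k)) *
        (C.enc (Fin.last n) (Fin.snoc (α := fun _ => X) x a) b' *
          C.dec (Fin.last n) (Fin.snoc (α := fun _ => B) b b')
            (Fin.snoc (α := fun _ => Y) y y₀) c) := by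
  rw [RSeqCode.channel, ← (Fin.snocEquiv (fun _ : Fin (n + 1) => B)).sum_comp,
    Fintype.sum_prod_type, Finset.sum_comm]
  refine Finset.sum_congr rfl fun b _ => Finset.sum_congr rfl fun b' _ => ?_
  have henc : ∀ k : Fin n, C.enc k.castSucc (Fin.snoc (α := fun _ => X) x a) =
      (C.init x₀ b₀ y₀).enc k x := fun k => C.enc_causal _ _ _ fun i hi => by
    induction i using Fin.lastCases with
    | last => exact absurd hi (not_le.2 (Fin.castSucc_lt_last k))
    | cast j => simp
  have hdec : ∀ k : Fin n, C.dec k.castSucc (Fin.snoc (α := fun _ => B) b b')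
      (Fin.snoc (α := fun _ => Y) y c) = (C.init x₀ b₀ y₀).dec k b y := fun k => by
    refine C.dec_causal _ _ _ _ _ (fun i hi => ?_) (fun i hi => ?_)
    · induction i using Fin.lastCases with
      | last => exact absurd hi (not_le.2 (Fin.castSucc_lt_last k))
      | cast j => simp
    · induction i using Fin.lastCases with
      | last => exact absurd hi.le (not_le.2 (Fin.castSucc_lt_last k))
      | cast j => simp
  have hlast : C.dec (Fin.last n) (Fin.snoc (α := fun _ => B) b b')
      (Fin.snoc (α := fun _ => Y) y c) = C.dec (Fin.last n) (Fin.snoc (α := fun _ => B) b b')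
      (Fin.snoc (α := fun _ => Y) y y₀) := by
    refine C.dec_causal _ _ _ _ _ (fun i _ => rfl) (fun i hi => ?_)
    induction i using Fin.lastCases with
    | last => exact absurd hi (lt_irrefl _)
    | cast j => simp
  simp only [Fin.snocEquiv, Equiv.coe_fn_mk, Fin.prod_univ_castSucc, Fin.snoc_castSucc,
    Fin.snoc_last, henc, hdec, hlast]
  ring

/-- Given the past inputs and outputs, the last epoch of a restricted code acts as a
symbol-by-symbol scheme. -/
theorem RSeqCode.exists_kernels_channel_snoc {X Y B : Type} [Fintype X] [Fintype Y]
    [Fintype B] {n : ℕ} (C : RSeqCode X Y B (n + 1)) (x₀ : X) (b₀ : B) (y₀ : Y)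
    (x : Fin n → X) (y : Fin n → Y) :
    ∃ (PB : X → B → ℝ) (PYB : B → Y → ℝ), IsKernel PB ∧ IsKernel PYB ∧ ∀ a c,
      C.channel (Fin.snoc (α := fun _ => X) x a) (Fin.snoc (α := fun _ => Y) y c) =
        (C.init x₀ b₀ y₀).channel x y * ∑ b, PB a b * PYB b c := by
  set w : (Fin n → B) → ℝ := fun b =>
    (∏ k, (C.init x₀ b₀ y₀).enc k x (b k)) * ∏ k, (C.init x₀ b₀ y₀).dec k b y (y k) with hw
  set D : (Fin n → B) → B → Y → ℝ := fun b b' =>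
    C.dec (Fin.last n) (Fin.snoc (α := fun _ => B) b b') (Fin.snoc (α := fun _ => Y) y y₀)
    with hD
  have hD_dist : ∀ b b', IsDist (D b b') := fun b b' => C.dec_dist _ _ _
  have hw0 : ∀ b, 0 ≤ w b := fun b => mul_nonneg
    (Finset.prod_nonneg fun k _ => ((C.init x₀ b₀ y₀).enc_dist _ _).1 _)
    (Finset.prod_nonneg fun k _ => ((C.init x₀ b₀ y₀).dec_dist _ _ _).1 _)
  have hW : (C.init x₀ b₀ y₀).channel x y = ∑ b, w b := rfl
  have hsnoc : ∀ a c,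
      C.channel (Fin.snoc (α := fun _ => X) x a) (Fin.snoc (α := fun _ => Y) y c) =
        ∑ b, ∑ b', w b *
          (C.enc (Fin.last n) (Fin.snoc (α := fun _ => X) x a) b' * D b b' c) :=
    fun a c => C.channel_snoc x₀ b₀ y₀ x a y c
  have hPB : IsKernel fun a => C.enc (Fin.last n) (Fin.snoc (α := fun _ => X) x a) :=
    fun a => C.enc_dist _ _
  by_cases h0 : ∑ b, w b = 0
  · refine ⟨_, D fun _ => b₀, hPB, fun b' => hD_dist _ b', fun a c => ?_⟩
    have hwz : ∀ b, w b = 0 := fun b =>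
      (Finset.sum_eq_zero_iff_of_nonneg fun b _ => hw0 b).1 h0 b (Finset.mem_univ b)
    simp [hsnoc, hW, hwz]
  · refine ⟨_, fun b' c => (∑ b, w b * D b b' c) / ∑ b, w b, hPB, fun b' => ⟨fun c => ?_, ?_⟩,
      fun a c => ?_⟩
    · exact div_nonneg (Finset.sum_nonneg fun b _ => mul_nonneg (hw0 b) ((hD_dist b b').1 c))
        (Finset.sum_nonneg fun b _ => hw0 b)
    · rw [← Finset.sum_div, Finset.sum_comm]
      simp_rw [← Finset.mul_sum, (hD_dist _ _).2, mul_one]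
      exact div_self h0
    · rw [hsnoc, hW, Finset.sum_comm, Finset.mul_sum]
      refine Finset.sum_congr rfl fun b' _ => ?_
      rw [mul_left_comm, mul_div_cancel₀ _ h0, Finset.mul_sum]
      exact Finset.sum_congr rfl fun b _ => by ring

theorem RSeqCode.isDist_and_mul_DeltaTilde_le_KL {X Y B : Type} [Fintype X] [Fintype Y]
    [Fintype B] {π : X × Y → ℝ} (hπ : IsDist π) {n : ℕ} (C : RSeqCode X Y B n) :
    IsDist (fun p : (Fin n → X) × (Fin n → Y) =>
      (∏ i, marg Prod.fst π (p.1 i)) * C.channel p.1 p.2) ∧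
    n * DeltaTilde X Y B π ≤ KL
      (fun p : (Fin n → X) × (Fin n → Y) =>
        (∏ i, marg Prod.fst π (p.1 i)) * C.channel p.1 p.2)
      (fun p => ∏ i, π (p.1 i, p.2 i)) := by
  induction n with
  | zero => exact ⟨⟨fun _ => by simp [RSeqCode.channel], by simp [RSeqCode.channel]⟩, by simp⟩
  | succ n ih =>
    obtain ⟨x₀, y₀⟩ : Nonempty (X × Y) := by
      by_contra h
      rw [not_nonempty_iff] at h
      simpa using hπ.2
    obtain ⟨b₀⟩ : Nonempty B := by
      by_contra h
      rw [not_nonempty_iff] at h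
      simpa using (C.enc_dist 0 fun _ => x₀).2
    obtain ⟨hdist, hle⟩ := ih (C.init x₀ b₀ y₀)
    choose PB PYB hPB hPYB hch using fun z : (Fin n → X) × (Fin n → Y) =>
      C.exists_kernels_channel_snoc x₀ b₀ y₀ z.1 z.2
    have hfactor : ∀ z : ((Fin n → X) × (Fin n → Y)) × (X × Y),
        (∏ i, marg Prod.fst π ((snocPairEquiv X Y n z).1 i)) *
          C.channel (snocPairEquiv X Y n z).1 (snocPairEquiv X Y n z).2 =
        ((∏ i, marg Prod.fst π (z.1.1 i)) * (C.init x₀ b₀ y₀).channel z.1.1 z.1.2) *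
          (marg Prod.fst π z.2.1 * ∑ b, PB z.1 z.2.1 b * PYB z.1 b z.2.2) := by
      intro z
      have h := hch z.1 z.2.1 z.2.2
      simp only [snocPairEquiv, Equiv.coe_fn_mk, Fin.prod_univ_castSucc, Fin.snoc_castSucc,
        Fin.snoc_last, h]
      ring
    have hR := fun z => hπ.marg_mul_kernel (hPB z) (hPYB z)
    refine ⟨IsDist.of_comp_equiv (snocPairEquiv X Y n) ?_, ?_⟩
    · simp only [hfactor]
      exact hdist.chain hR
    · rw [← KL_comp_equiv (snocPairEquiv X Y n)]
      simp only [hfactor, prod_snocPairEquiv]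
      refine le_trans ?_ (KL_add_le_KL_chain hdist (hπ.pi_pair n) hR hπ
        (δ := DeltaTilde X Y B π) fun z => sInf_le ⟨PB z, PYB z, hPB z, hPYB z, rfl⟩)
      rw [Nat.cast_succ, add_mul, one_mul]
      gcongr

theorem RGammaN_div_eq_DeltaTilde {X Y B : Type} [Fintype X] [Fintype Y] [Fintype B]
    {π : X × Y → ℝ} (hπ : IsDist π) {n : ℕ} (hn : n ≠ 0) :
    RGammaN X Y B π n / (n : ℝ≥0∞) = DeltaTilde X Y B π := by
  have hn0 : (n : ℝ≥0∞) ≠ 0 := Nat.cast_ne_zero.2 hn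
  have hnt : (n : ℝ≥0∞) ≠ ⊤ := ENNReal.natCast_ne_top n
  refine le_antisymm (le_sInf ?_) ?_
  · rintro _ ⟨PB, PYB, hPB, hPYB, rfl⟩
    exact ENNReal.div_le_of_le_mul' (RGammaN_le hπ hPB hPYB n)
  · rw [ENNReal.le_div_iff_mul_le (Or.inl hn0) (Or.inl hnt), mul_comm]
    refine le_sInf ?_
    rintro _ ⟨C, rfl⟩
    exact (C.isDist_and_mul_DeltaTilde_le_KL hπ).2

/-- with restricted encoders `P_{B_k|X^k}` and decoders
`P_{Y_k|B^k Y^{k-1}}`, the optimal asymptotic normalized divergence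
`Γ̃₀(π_{XY}) = lim_n (1/n)·Γ̃₀^{(n)}` exists and equals `Δ̃(π_{XY})`. -/
theorem restricted_sequential_synthesis
    (X Y B : Type) [Fintype X] [Fintype Y] [Fintype B]
    (π : X × Y → ℝ) (hπ : IsDist π) :
    Filter.Tendsto (fun n : ℕ => RGammaN X Y B π n / (n : ℝ≥0∞)) Filter.atTop
      (nhds (DeltaTilde X Y B π)) := by
  refine tendsto_const_nhds.congr' ?_
  filter_upwards [Filter.eventually_ne_atTop 0] with n hn
  exact (RGammaN_div_eq_DeltaTilde hπ hn).symm

end
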